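/- Let X be a positive semidefinite n×n complex matrix and E an n×n matrix with 0 ≤ E ≤ 1 (Loewner order). Then Re(trace(X·E)) ≤ ‖X·E‖₁ ≤ √(trace X) · √(Re(trace(X·E))), where ‖M‖₁ denotes the trace norm of M, i.e. the trace of the positive semidefinite square root of Mᴴ·M. In particular, for a density matrix ρ (positive semidefinite with trace 1) and a projection P, Re(trace(ρ·P)) ≤ ‖ρ·P‖₁ ≤ √(Re(trace(ρ·P))). -/

import Mathlib

open Matrix BigOperators
open scoped ComplexOrder MatrixOrder

noncomputable section

/-- Loewner order: `M ≤ N` iff `N - M` is positive semidefinite. -/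
def loe {n : Type*} [Fintype n] (M N : Matrix n n ℂ) : Prop := (N - M).PosSemidef

/-- A projection: Hermitian and idempotent. -/
def IsProj {n : Type*} [Fintype n] (M : Matrix n n ℂ) : Prop := M.IsHermitian ∧ M * M = M

/-- The trace norm of a matrix: the trace of the positive semidefinite square root
of `Mᴴ * M`. -/
def traceNorm {n : Type*} [Fintype n] [DecidableEq n] (M : Matrix n n ℂ) : ℝ :=
  (CFC.sqrt (Mᴴ * M)).trace.re

section
variable {n : Type*} [Fintype n]

/-- The trace of a product of two positive semidefinite matrices is nonnegative. -/
theorem trace_mul_re_nonneg {A B : Matrix n n ℂ} (hA : A.PosSemidef) (hB : B.PosSemidef) :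
    0 ≤ (A * B).trace.re := by
  classical
  obtain ⟨C, rfl⟩ := CStarAlgebra.nonneg_iff_eq_star_mul_self.mp hA.nonneg
  rw [star_eq_conjTranspose, Matrix.mul_assoc, Matrix.trace_mul_comm]
  exact (Complex.le_def.mp (hB.mul_mul_conjTranspose_same C).trace_nonneg).1

/-- The Cauchy–Schwarz inequality for the form `(A, B) ↦ Re tr(Aᴴ X B)`. -/
theorem trace_conjTranspose_mul_mul_re_le {X : Matrix n n ℂ} (hX : X.PosSemidef)
    (A B : Matrix n n ℂ) :
    (Aᴴ * X * B).trace.re ≤ √(Aᴴ * X * A).trace.re * √(Bᴴ * X * B).trace.re := by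
  have hnn (C : Matrix n n ℂ) : 0 ≤ (Cᴴ * X * C).trace.re :=
    (Complex.le_def.mp (hX.conjTranspose_mul_mul_same C).trace_nonneg).1
  have hsymm : (Bᴴ * X * A).trace.re = (Aᴴ * X * B).trace.re := by
    have h : Bᴴ * X * A = (Aᴴ * X * B)ᴴ := by
      simp [Matrix.mul_assoc, hX.isHermitian.eq]
    rw [h, trace_conjTranspose]
    simp
  have hquad (t : ℝ) : 0 ≤ (Aᴴ * X * A).trace.re * (t * t) +
      (-2 * (Aᴴ * X * B).trace.re) * t + (Bᴴ * X * B).trace.re := by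
    have h := hnn ((t : ℂ) • A - B)
    simp only [conjTranspose_sub, conjTranspose_smul, Matrix.sub_mul, Matrix.mul_sub,
      Matrix.smul_mul, Matrix.mul_smul, trace_sub, trace_smul, smul_eq_mul, Complex.sub_re,
      Complex.star_def, Complex.conj_ofReal, Complex.re_ofReal_mul, hsymm] at h
    linarith
  have hd := discrim_le_zero hquad
  rw [← Real.sqrt_mul (hnn A)]
  apply Real.le_sqrt_of_sq_le
  rw [discrim] at hd
  linarith

/-- The square of an effect is dominated by the effect. -/
theorem posSemidef_sub_mul_self [DecidableEq n] {E : Matrix n n ℂ} (h0 : E.PosSemidef)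
    (h1 : (1 - E).PosSemidef) : (E - E * E).PosSemidef := by
  have h := (h1.conjTranspose_mul_mul_same E).add (h0.conjTranspose_mul_mul_same (1 - E))
  rw [h0.isHermitian.eq, h1.isHermitian.eq] at h
  convert h using 1
  noncomm_ring

/-- A Hermitian idempotent matrix is positive semidefinite. -/
theorem IsProj.posSemidef {P : Matrix n n ℂ} (hP : IsProj P) : P.PosSemidef := by
  have h := posSemidef_conjTranspose_mul_self P
  rwa [hP.1.eq, hP.2] at h

/-- The complement of a projection is a projection. -/
theorem IsProj.one_sub [DecidableEq n] {P : Matrix n n ℂ} (hP : IsProj P) : IsProj (1 - P) := by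
  refine ⟨isHermitian_one.sub hP.1, ?_⟩
  simp [Matrix.sub_mul, Matrix.mul_sub, hP.2]

/-- A Hermitian matrix has a commuting Hermitian pseudoinverse. -/
theorem Matrix.IsHermitian.exists_pseudoinverse [DecidableEq n] {S : Matrix n n ℂ}
    (hS : S.IsHermitian) :
    ∃ T : Matrix n n ℂ, T.IsHermitian ∧ T * S = S * T ∧ S * T * S = S ∧ T * S * T = T := by
  have hS' : IsSelfAdjoint S := hS
  have hc (f : ℝ → ℝ) : ContinuousOn f (spectrum ℝ S) := S.finite_real_spectrum.continuousOn f
  have hmul (f g : ℝ → ℝ) : cfc f S * cfc g S = cfc (fun x => f x * g x) S :=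
    (cfc_mul f g S (hc f) (hc g)).symm
  have hcomm := (hmul (·⁻¹) (fun x => x)).trans
    ((congrArg (cfc · S) (funext fun x => mul_comm x⁻¹ x)).trans (hmul (fun x => x) (·⁻¹)).symm)
  have hSTS : cfc (fun x : ℝ => x) S * cfc (·⁻¹ : ℝ → ℝ) S * cfc (fun x : ℝ => x) S =
      cfc (fun x : ℝ => x) S := by
    simp only [hmul, mul_inv_mul_cancel]
  have hTST : cfc (·⁻¹ : ℝ → ℝ) S * cfc (fun x : ℝ => x) S * cfc (·⁻¹ : ℝ → ℝ) S =
      cfc (·⁻¹ : ℝ → ℝ) S := by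
    rw [hmul, hmul]
    exact congrArg (cfc · S) (funext fun x => by simpa using mul_inv_mul_cancel x⁻¹)
  rw [cfc_id' ℝ S] at hcomm hSTS hTST
  exact ⟨cfc (·⁻¹ : ℝ → ℝ) S, cfc_predicate (p := IsSelfAdjoint) _ S, hcomm, hSTS, hTST⟩

/-- Polar decomposition with a partial isometry. -/
theorem exists_polar [DecidableEq n] (M : Matrix n n ℂ) :
    ∃ V : Matrix n n ℂ, M = V * CFC.sqrt (Mᴴ * M) ∧ Vᴴ * M = CFC.sqrt (Mᴴ * M) ∧
      IsProj (V * Vᴴ) ∧ CFC.sqrt (Mᴴ * M) * (Vᴴ * V) = CFC.sqrt (Mᴴ * M) := by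
  have hSS : CFC.sqrt (Mᴴ * M) * CFC.sqrt (Mᴴ * M) = Mᴴ * M :=
    CFC.sqrt_mul_sqrt_self _ (posSemidef_conjTranspose_mul_self M).nonneg
  have hS : (CFC.sqrt (Mᴴ * M)).IsHermitian :=
    (Matrix.nonneg_iff_posSemidef.mp (CFC.sqrt_nonneg (Mᴴ * M))).isHermitian
  generalize CFC.sqrt (Mᴴ * M) = S at hSS hS ⊢
  obtain ⟨T, hT, hcomm, hSTS, hTST⟩ := hS.exists_pseudoinverse
  have hVM : (M * T)ᴴ * M = S := by
    rw [conjTranspose_mul, hT.eq, Matrix.mul_assoc, ← hSS, ← Matrix.mul_assoc, hcomm, hSTS]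
  have hVV : (M * T)ᴴ * (M * T) = S * T := by rw [← Matrix.mul_assoc, hVM]
  refine ⟨M * T, ?_, hVM, ⟨isHermitian_mul_conjTranspose_self _, ?_⟩, ?_⟩
  · rw [← sub_eq_zero, ← conjTranspose_mul_self_eq_zero]
    have h : M - M * T * S = M * (1 - T * S) := by noncomm_ring
    have h0 : S * (1 - T * S) = 0 := by
      rw [Matrix.mul_sub, ← Matrix.mul_assoc, hSTS, Matrix.mul_one, sub_self]
    rw [h, conjTranspose_mul, Matrix.mul_assoc, ← Matrix.mul_assoc Mᴴ, ← hSS, Matrix.mul_assoc S,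
      h0, Matrix.mul_zero, Matrix.mul_zero]
  · have h : M * T * (S * T) = M * T := by
      rw [Matrix.mul_assoc, ← Matrix.mul_assoc T, hTST]
    rw [← Matrix.mul_assoc, Matrix.mul_assoc (M * T) _ (M * T), hVV, h]
  · rw [hVV, ← hcomm, ← Matrix.mul_assoc, hSTS]

/-- The real part of the trace is at most the trace norm. -/
theorem trace_re_le_traceNorm [DecidableEq n] (M : Matrix n n ℂ) :
    M.trace.re ≤ traceNorm M := by
  obtain ⟨V, hM, -, -, hV⟩ := exists_polar M
  have hS : (CFC.sqrt (Mᴴ * M)).PosSemidef :=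
    Matrix.nonneg_iff_posSemidef.mp (CFC.sqrt_nonneg (Mᴴ * M))
  rw [traceNorm]
  generalize CFC.sqrt (Mᴴ * M) = S at *
  have h := trace_mul_re_nonneg hS (posSemidef_conjTranspose_mul_self (1 - V))
  have hexp : S * ((1 - V)ᴴ * (1 - V)) = S - S * V - S * Vᴴ + S * (Vᴴ * V) := by
    rw [conjTranspose_sub, conjTranspose_one]
    noncomm_ring
  have h1 : (S * V).trace = M.trace := by rw [trace_mul_comm, ← hM]
  have h2 : (S * Vᴴ).trace = star M.trace := by
    rw [← trace_conjTranspose, hM, conjTranspose_mul, hS.isHermitian.eq]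
  rw [hexp, hV, trace_add, trace_sub, trace_sub, h1, h2] at h
  simp only [Complex.add_re, Complex.sub_re, Complex.star_def, Complex.conj_re] at h
  linarith

/-- Upper bound on the trace norm of the product of a positive semidefinite matrix and an
effect. -/
theorem traceNorm_mul_le [DecidableEq n] {X E : Matrix n n ℂ} (hX : X.PosSemidef)
    (hE0 : E.PosSemidef) (hE1 : (1 - E).PosSemidef) :
    traceNorm (X * E) ≤ √X.trace.re * √(X * E).trace.re := by
  obtain ⟨V, -, hVM, hV, -⟩ := exists_polar (X * E)
  rw [traceNorm, ← hVM, ← Matrix.mul_assoc]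
  refine (trace_conjTranspose_mul_mul_re_le hX V E).trans ?_
  refine mul_le_mul (Real.sqrt_le_sqrt ?_) (Real.sqrt_le_sqrt ?_) (Real.sqrt_nonneg _)
    (Real.sqrt_nonneg _)
  · have h := trace_mul_re_nonneg hX hV.one_sub.posSemidef
    rw [Matrix.mul_sub, Matrix.mul_one, trace_sub, Complex.sub_re] at h
    rw [Matrix.mul_assoc, trace_mul_comm, Matrix.mul_assoc]
    linarith
  · have h := trace_mul_re_nonneg hX (posSemidef_sub_mul_self hE0 hE1)
    rw [Matrix.mul_sub, trace_sub, Complex.sub_re] at h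
    rw [hE0.isHermitian.eq, Matrix.mul_assoc, trace_mul_comm, Matrix.mul_assoc]
    linarith

end

/-- `Re tr(XE) ≤ ‖XE‖₁ ≤ √(tr X)·√(Re tr(XE))` for PSD `X` and a POVM element `E`;
in particular `Re tr(ρP) ≤ ‖ρP‖₁ ≤ √(Re tr(ρP))` for a state `ρ` and a projection `P`. -/
theorem traceNorm_bounds {n : Type*} [Fintype n] [DecidableEq n]
    (X E : Matrix n n ℂ) (hX : X.PosSemidef) (hE0 : loe 0 E) (hE1 : loe E 1) :
    ((X * E).trace.re ≤ traceNorm (X * E) ∧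
      traceNorm (X * E) ≤ Real.sqrt X.trace.re * Real.sqrt (X * E).trace.re) ∧
    ∀ ρ P : Matrix n n ℂ, ρ.PosSemidef → ρ.trace = 1 → IsProj P →
      ((ρ * P).trace.re ≤ traceNorm (ρ * P) ∧
        traceNorm (ρ * P) ≤ Real.sqrt (ρ * P).trace.re) := by
  refine ⟨⟨trace_re_le_traceNorm _, traceNorm_mul_le hX (by simpa [loe] using hE0) hE1⟩,
    fun ρ P hρ htr hP => ⟨trace_re_le_traceNorm _, ?_⟩⟩
  simpa [htr] using traceNorm_mul_le hρ hP.posSemidef hP.one_sub.posSemidef
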